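/- arXiv:0812.3454 — 2 statements merged into one kernel-verified Lean document; each statement's English description precedes it below -/
import Mathlib

section
/- Let k be an algebraically closed field, K a field extension of k finitely generated as a field over k, R a valuation subring of K containing k with maximal ideal m_R, and K' an intermediate field k ⊆ K' ⊆ K. Suppose f_1, …, f_r are elements of K' ∩ R whose residues modulo K' ∩ m_R form a transcendence basis over k of the quotient ring (K' ∩ R)/(K' ∩ m_R), and suppose g_1, …, g_s are elements of R such that the residues of f_1, …, f_r, g_1, …, g_s in R/m_R are algebraically independent over k. Then g_1, …, g_s are algebraically independent over K' (in particular each g_j is transcendental over K'). -/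
/-!
Statement 1 (Lemma 16): if residues of `f_1,...,f_r` form a transcendence basis of
`(K' ∩ R)/(K' ∩ m_R)` over `k`, and the residues of `f_1,...,f_r,g_1,...,g_s` in `R/m_R`
are algebraically independent over `k`, then `g_1,...,g_s` are algebraically independent
over `K'` (in particular each `g_j` is transcendental over `K'`).
-/

open IsLocalRing

/-- The transcendence degree of a commutative ring `A` over a commutative ring `k`,
computed along a given ring homomorphism `f : k →+* A`:  the supremum of the
cardinalities of subsets of `A` that are algebraically independent over `k`
(with respect to the `k`-algebra structure induced by `f`). -/
noncomputable def trdegAlong {k A : Type*} [CommRing k] [CommRing A] (f : k →+* A) : Cardinal :=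
  letI : Algebra k A := f.toAlgebra
  ⨆ s : { s : Set A // AlgebraicIndependent k ((↑) : s → A) }, Cardinal.mk s.1

section Inter

variable {k K : Type*} [Field k] [Field K] [Algebra k K]

/-- The subring `K' ∩ R` of `K`. -/
abbrev interSubring (K' : IntermediateField k K) (R : ValuationSubring K) : Subring K :=
  K'.toSubring ⊓ R.toSubring

/-- The inclusion `K' ∩ R →+* R`. -/
def interIncl (K' : IntermediateField k K) (R : ValuationSubring K) :
    interSubring K' R →+* R :=
  RingHom.codRestrict (interSubring K' R).subtype R fun x =>
    (ValuationSubring.mem_toSubring R _).mp (Subring.mem_inf.mp x.2).2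

/-- The ideal `K' ∩ m_R` of the ring `K' ∩ R`, where `m_R` is the maximal ideal of `R`. -/
def interMaxIdeal (K' : IntermediateField k K) (R : ValuationSubring K) :
    Ideal (interSubring K' R) :=
  (maximalIdeal R).comap (interIncl K' R)

/-- The natural map `k →+* (K' ∩ R) ⧸ (K' ∩ m_R)`, assuming `k ⊆ R`. -/
noncomputable def kToInterRes (K' : IntermediateField k K) (R : ValuationSubring K)
    (hkR : Set.range (algebraMap k K) ⊆ (R : Set K)) :
    k →+* interSubring K' R ⧸ interMaxIdeal K' R :=
  (Ideal.Quotient.mk (interMaxIdeal K' R)).comp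
    (RingHom.codRestrict (algebraMap k K) (interSubring K' R) fun x =>
      Subring.mem_inf.mpr ⟨K'.algebraMap_mem x,
        (ValuationSubring.mem_toSubring R _).mpr (hkR ⟨x, rfl⟩)⟩)

end Inter

/-- If `x` is a transcendence basis of a domain `S` over `k`, and `y` together with the image of `x`
in an extension `A` of `S` is algebraically independent over `k`, then `y` is algebraically
independent over `S`. -/
theorem IsTranscendenceBasis.algebraicIndependent_of_sumElim {ι ι' k S A : Type*} [CommRing k]
    [Nontrivial k] [CommRing S] [NoZeroDivisors S] [CommRing A] [Algebra k S] [Algebra k A]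
    [Algebra S A] [IsScalarTower k S A] {x : ι → S} {y : ι' → A} (hx : IsTranscendenceBasis k x)
    (hinj : Function.Injective (algebraMap S A))
    (hxy : AlgebraicIndependent k (Sum.elim y (algebraMap S A ∘ x))) :
    AlgebraicIndependent S y := by
  have hy := (AlgebraicIndependent.sumElim_iff.mp hxy).2
  let φ : S →ₐ[k] A := IsScalarTower.toAlgHom k S A
  let T₀ := Algebra.adjoin k (Set.range x)
  let T := Algebra.adjoin k (Set.range (algebraMap S A ∘ x))
  have hT : ∀ a : T₀, φ a ∈ T := fun a => by
    have h : φ a ∈ T₀.map φ := ⟨a, a.2, rfl⟩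
    rwa [AlgHom.map_adjoin, ← Set.range_comp] at h
  let ψ : T₀ →ₐ[k] T := (φ.comp T₀.val).codRestrict T hT
  let : Algebra T₀ T := ψ.toAlgebra
  have : IsScalarTower T₀ T A := .of_algebraMap_eq fun _ => rfl
  have hψ : Function.Injective (algebraMap T₀ T) := fun a b hab =>
    Subtype.ext (hinj (congrArg Subtype.val hab))
  have hy₀ : AlgebraicIndependent T₀ y := hy.restrictScalars hψ
  have : Algebra.IsAlgebraic T₀ S := hx.isAlgebraic
  exact hy₀.extendScalars S

section Inter

variable {k K : Type*} [Field k] [Field K] [Algebra k K]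

/-- A nonzero polynomial over `K'` can be rescaled to have coefficients in `K' ∩ R`, with one
coefficient equal to `1`. -/
theorem exists_map_eq_C_mul_coeff_eq_one {ι : Type*} (K' : IntermediateField k K)
    (R : ValuationSubring K) {p : MvPolynomial ι K'} (hp : p ≠ 0) :
    ∃ (q : MvPolynomial ι (interSubring K' R)) (c : K') (m : ι →₀ ℕ),
      MvPolynomial.map (Subring.inclusion (inf_le_left : interSubring K' R ≤ K'.toSubring)) q =
        MvPolynomial.C c * p ∧ q.coeff m = 1 := by
  obtain ⟨m, hm, hmax⟩ := p.support.exists_max_image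
    (fun n => R.valuation ((p.coeff n : K') : K)) (MvPolynomial.support_nonempty.mpr hp)
  have hc : p.coeff m ≠ 0 := MvPolynomial.mem_support_iff.mp hm
  set j : interSubring K' R →+* K' :=
    Subring.inclusion (inf_le_left : interSubring K' R ≤ K'.toSubring)
  have hj : Function.Injective j := Subring.inclusion_injective inf_le_left
  have hmem : MvPolynomial.C (p.coeff m)⁻¹ * p ∈ (MvPolynomial.map j).range := by
    refine MvPolynomial.mem_range_map_iff_coeffs_subset.mpr ?_
    intro a ha
    obtain ⟨n, hn, rfl⟩ := MvPolynomial.mem_coeffs_iff.mp ha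
    have hle : R.valuation ((p.coeff n : K') : K) ≤ R.valuation ((p.coeff m : K') : K) := by
      by_cases h : n ∈ p.support
      · exact hmax n h
      · simp [MvPolynomial.notMem_support_iff.mp h]
    refine ⟨⟨_, ((p.coeff m)⁻¹ * p.coeff n).2, R.mem_of_valuation_le_one _ ?_⟩, ?_⟩
    · have hpos : 0 < R.valuation ((p.coeff m : K') : K) := by simpa [Valuation.pos_iff] using hc
      simpa [mul_comm, ← div_eq_mul_inv] using div_le_one_of_le₀ hle hpos.le
    · rw [MvPolynomial.coeff_C_mul]
      rfl
  obtain ⟨q, hq⟩ := hmem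
  refine ⟨q, (p.coeff m)⁻¹, m, hq, hj ?_⟩
  rw [← MvPolynomial.coeff_map]
  rw [hq, MvPolynomial.coeff_C_mul, inv_mul_cancel₀ hc, map_one]

/-- The embedding of `(K' ∩ R) ⧸ (K' ∩ m_R)` into the residue field of `R`. -/
noncomputable def interResMap (K' : IntermediateField k K) (R : ValuationSubring K) :
    interSubring K' R ⧸ interMaxIdeal K' R →+* ResidueField R :=
  Ideal.quotientMap (maximalIdeal R) (interIncl K' R) le_rfl

theorem interResMap_injective (K' : IntermediateField k K) (R : ValuationSubring K) :
    Function.Injective (interResMap K' R) :=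
  Ideal.quotientMap_injective

/-- Elements of `R` whose residues are algebraically independent over the residue field of `K' ∩ R`
are algebraically independent over `K'`. -/
theorem algebraicIndependent_of_residue {ι : Type*} (K' : IntermediateField k K)
    (R : ValuationSubring K) (g : ι → R)
    (hg : letI := (interResMap K' R).toAlgebra
      AlgebraicIndependent (interSubring K' R ⧸ interMaxIdeal K' R) fun i => residue R (g i)) :
    AlgebraicIndependent K' fun i => (g i : K) := by
  let := (interResMap K' R).toAlgebra
  rw [algebraicIndependent_iff] at hg ⊢
  intro p hp
  by_contra hp0
  obtain ⟨q, c, m, hq, hqm⟩ := exists_map_eq_C_mul_coeff_eq_one K' R hp0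
  have hqK : MvPolynomial.aeval (fun i => (g i : K)) (MvPolynomial.C c * p) = 0 := by
    rw [map_mul, hp, mul_zero]
  rw [← hq, MvPolynomial.aeval_def, MvPolynomial.eval₂_map] at hqK
  have hqR : MvPolynomial.eval₂ (interIncl K' R) g q = 0 := by
    apply Subtype.val_injective
    refine (MvPolynomial.eval₂_comp_left R.subtype (interIncl K' R) g q).trans ?_
    exact hqK
  have hres := congrArg (residue R) hqR
  rw [MvPolynomial.eval₂_comp_left, map_zero] at hres
  have h0 := hg (MvPolynomial.map (Ideal.Quotient.mk (interMaxIdeal K' R)) q) (by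
    rw [MvPolynomial.aeval_def, MvPolynomial.eval₂_map]
    exact hres)
  have h1 := congrArg (MvPolynomial.coeff m) h0
  rw [MvPolynomial.coeff_map, hqm, MvPolynomial.coeff_zero] at h1
  have h2 := congrArg (interResMap K' R) h1
  rw [map_one, map_one, map_zero] at h2
  exact one_ne_zero h2

end Inter

theorem stmt1 (k K : Type*) [Field k] [IsAlgClosed k] [Field K] [Algebra k K]
    (hfg : ∃ s : Finset K, IntermediateField.adjoin k (s : Set K) = ⊤)
    (R : ValuationSubring K) (hkR : Set.range (algebraMap k K) ⊆ (R : Set K))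
    (K' : IntermediateField k K)
    (r s : ℕ) (f : Fin r → K) (hfK' : ∀ i, f i ∈ K') (hfR : ∀ i, f i ∈ R)
    (g : Fin s → R) :
    letI : Algebra k (interSubring K' R ⧸ interMaxIdeal K' R) := (kToInterRes K' R hkR).toAlgebra
    letI : Algebra k (ResidueField R) :=
      ((residue R).comp (RingHom.codRestrict (algebraMap k K) R fun x => hkR ⟨x, rfl⟩)).toAlgebra
    -- the residues of the `f i` form a transcendence basis of `(K' ∩ R)/(K' ∩ m_R)` over `k`
    IsTranscendenceBasis k (fun i : Fin r => Ideal.Quotient.mk (interMaxIdeal K' R)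
        ⟨f i, Subring.mem_inf.mpr ⟨hfK' i, (ValuationSubring.mem_toSubring R _).mpr (hfR i)⟩⟩) →
    -- the residues of the `f i` and `g j` in `R/m_R` are algebraically independent over `k`
    AlgebraicIndependent k (Fin.append (fun i : Fin r => residue R ⟨f i, hfR i⟩)
        (fun j : Fin s => residue R (g j))) →
    -- conclusion: the `g j` are algebraically independent (hence transcendental) over `K'`
    (AlgebraicIndependent K' (fun j : Fin s => (g j : K)) ∧
      ∀ j : Fin s, Transcendental K' ((g j : K))) := by
  intro hf hfg'
  let := (kToInterRes K' R hkR).toAlgebra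
  let := ((residue R).comp
    (RingHom.codRestrict (algebraMap k K) R fun x => hkR ⟨x, rfl⟩)).toAlgebra
  let := (interResMap K' R).toAlgebra
  have : IsScalarTower k (interSubring K' R ⧸ interMaxIdeal K' R) (ResidueField R) :=
    .of_algebraMap_eq fun _ => rfl
  have : NoZeroDivisors (interSubring K' R ⧸ interMaxIdeal K' R) :=
    (interResMap_injective K' R).noZeroDivisors _ (map_zero _) (map_mul _)
  have hsum := hfg'.comp (finSumFinEquiv ∘ Sum.swap)
    (finSumFinEquiv.injective.comp Sum.swap_leftInverse.injective)
  have hind := algebraicIndependent_of_residue K' R g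
    (hf.algebraicIndependent_of_sumElim (interResMap_injective K' R) (by
      convert hsum using 1
      ext (j | i)
      · simp
      · simp only [Function.comp_apply, Sum.elim_inr, Sum.swap_inr, finSumFinEquiv_apply_left,
          Fin.append_left]
        rfl))
  exact ⟨hind, hind.transcendental⟩
end

section
/- Let k be an algebraically closed field and K' a field extension of k that is finitely generated as a field over k, with trdeg_k K' = m. Let O be a valuation subring of K' containing k whose maximal ideal m_O is nonzero. Then the residue field O/m_O has transcendence degree at most m − 1 over k. -/
/-!
Statement 3: if `O` is a valuation subring of a finitely generated field extension `K'`
of an algebraically closed field `k`, containing `k`, whose maximal ideal is nonzero,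
then the residue field `O/m_O` has transcendence degree at most `m - 1` over `k`,
where `m = trdeg_k K'`.
-/

open IsLocalRing

/-- Adjoining a nonzero element of the kernel of `f` to a family with algebraically independent
image under `f` yields an algebraically independent family. -/
theorem AlgebraicIndependent.option_of_mem_ker {R A B ι : Type*} [CommRing R] [CommRing A]
    [IsDomain A] [CommRing B] [Algebra R A] [Algebra R B] (f : A →ₐ[R] B) {x : ι → A}
    (hx : AlgebraicIndependent R (f ∘ x)) {t : A} (ht : t ≠ 0) (hft : f t = 0) :
    AlgebraicIndependent R (fun o : Option ι => o.elim t x) := by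
  have hx' : AlgebraicIndependent R x := AlgebraicIndependent.of_comp f hx
  rw [hx'.option_iff_transcendental]
  intro halg
  refine Ideal.comap_ne_bot_of_algebraic_mem (I := RingHom.ker f) ht hft halg ?_
  rw [eq_bot_iff]
  rintro ⟨a, ha⟩ hfa
  rw [Algebra.adjoin_range_eq_range_aeval] at ha
  obtain ⟨p, rfl⟩ := ha
  have hp : f (MvPolynomial.aeval x p) = 0 := hfa
  have hp0 : p = 0 := hx.eq_zero_of_aeval_eq_zero p (by
    rw [← hp, ← AlgHom.comp_apply, MvPolynomial.comp_aeval]; rfl)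
  exact Subtype.ext (by simp [hp0])

theorem trdegAlong_algebraMap {k A : Type*} [CommRing k] [CommRing A] [inst : Algebra k A] :
    trdegAlong (algebraMap k A) = Algebra.trdeg k A := by
  have h : (algebraMap k A).toAlgebra = inst := Algebra.algebra_ext _ _ fun _ => rfl
  unfold trdegAlong
  rw [h]
  rfl

theorem stmt3 (k K' : Type*) [Field k] [IsAlgClosed k] [Field K'] [Algebra k K']
    (hfg : ∃ s : Finset K', IntermediateField.adjoin k (s : Set K') = ⊤)
    (m : ℕ) (hm : trdegAlong (algebraMap k K') = m)
    (O : ValuationSubring K') (hkO : Set.range (algebraMap k K') ⊆ (O : Set K'))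
    (hmO : maximalIdeal O ≠ ⊥) :
    trdegAlong ((residue O).comp
        (RingHom.codRestrict (algebraMap k K') O fun x => hkO ⟨x, rfl⟩)) ≤
      ((m - 1 : ℕ) : Cardinal) := by
  rw [trdegAlong_algebraMap] at hm
  let φ : k →+* O := RingHom.codRestrict (algebraMap k K') O fun x => hkO ⟨x, rfl⟩
  let : Algebra k O := φ.toAlgebra
  let : Algebra k (ResidueField O) := ((residue O).comp φ).toAlgebra
  let f : O →ₐ[k] ResidueField O := { residue O with commutes' := fun _ => rfl }
  let g : O →ₐ[k] K' := { O.subtype with commutes' := fun _ => rfl }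
  obtain ⟨t, ht, ht0⟩ := Submodule.exists_mem_ne_zero_of_ne_bot hmO
  refine ciSup_le' fun ⟨s, hs⟩ => ?_
  choose x hx using fun b : s => residue_surjective (R := O) (b : ResidueField O)
  have hfx : AlgebraicIndependent k (f ∘ x) := by
    convert hs using 1
    exact funext hx
  have hind := (hfx.option_of_mem_ker f ht0 ((residue_eq_zero_iff t).2 ht)).map'
    (f := g) Subtype.val_injective
  have hle := hind.cardinalMk_le_trdeg
  rw [hm, Cardinal.mk_option] at hle
  obtain ⟨n, hn⟩ := Cardinal.lt_aleph0.1
    ((le_self_add.trans hle).trans_lt (Cardinal.natCast_lt_aleph0 (n := m)))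
  rw [hn] at hle ⊢
  norm_cast at hle ⊢
  omega
end
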